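/- Let φ : A(𝕋) × A(𝕋) → ℂ be a bounded bilinear map with ‖φ‖ ≤ 1, and let 0 ≤ α ≤ 1 be such that |φ(f,g)| ≤ α‖f‖_{A(𝕋)}‖g‖_{A(𝕋)} whenever f, g ∈ A(𝕋) satisfy supp f ∩ supp g = ∅. Then for all f, g, h ∈ A(𝕋), |φ(fg, h) − φ(f, gh)| ≤ 12·√(π(1+√2))·√α·‖f‖_{A(𝕋)}‖g‖_{A(𝕋)}‖h‖_{A(𝕋)}. -/

import Mathlib

open MeasureTheory AddCircle

noncomputable section

local instance : Fact (0 < 2 * Real.pi) := ⟨by positivity⟩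

/-- The circle `𝕋 = ℝ/2πℤ`. -/
abbrev Circle2Pi : Type := AddCircle (2 * Real.pi)

/-- Membership in the Fourier algebra `A(𝕋)`: continuity together with absolute
summability of the Fourier coefficients. -/
def MemFourierAlg (f : Circle2Pi → ℂ) : Prop :=
  Continuous f ∧ Summable fun n : ℤ => ‖fourierCoeff f n‖

/-- The norm of the Fourier algebra `A(𝕋)`: `‖f‖ = ∑ₙ |f̂(n)|`. -/
def fourierAlgNorm (f : Circle2Pi → ℂ) : ℝ :=
  ∑' n : ℤ, ‖fourierCoeff f n‖

/-- Normalized convolution on `𝕋` (with respect to the probability Haar measure). -/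
def circleConv (f g : Circle2Pi → ℂ) : Circle2Pi → ℂ :=
  fun x => ∫ y : Circle2Pi, f y * g (x - y) ∂haarAddCircle


/-- The exponential as a bare function. -/
def EE (n : ℤ) : Circle2Pi → ℂ := fun x => fourier n x

lemma EE_norm (n : ℤ) (x : Circle2Pi) : ‖EE n x‖ = 1 := by
  simp [EE, Circle.norm_coe]

lemma EE_cont (n : ℤ) : Continuous (EE n) := (fourier n).continuous

lemma EE_add (m n : ℤ) (x : Circle2Pi) : EE (m + n) x = EE m x * EE n x := by
  simp only [EE]; exact fourier_add

lemma EE_zero (x : Circle2Pi) : EE 0 x = 1 := by simp [EE]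

lemma EE_add_arg (n : ℤ) (x y : Circle2Pi) : EE n (x + y) = EE n x * EE n y := by
  simp [EE, smul_add, toCircle_add]

lemma EE_zsmul (m n : ℤ) (x : Circle2Pi) : EE m (n • x) = EE (n * m) x := by
  simp [EE, smul_smul, mul_comm]

lemma cont_integrable {f : Circle2Pi → ℂ} (hf : Continuous f) :
    Integrable f (haarAddCircle : Measure Circle2Pi) :=
  hf.integrable_of_hasCompactSupport (HasCompactSupport.of_compactSpace f)

lemma EE_integral (n : ℤ) : ∫ x, EE n x ∂(haarAddCircle : Measure Circle2Pi) = if n = 0 then 1 else 0 := by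
  have := congrFun (fourierCoeff_fourier (T := 2 * Real.pi) n) 0
  simp only [fourierCoeff, neg_zero, fourier_zero, one_smul] at this
  simp only [EE]
  rw [this]
  by_cases h : n = 0
  · subst h; simp
  · simp [h, Ne.symm h]

lemma rep_coeff {ι : Type*} [Countable ι] (a : ι → ℂ) (ν : ι → ℤ)
    (ha : Summable fun i => ‖a i‖) (f : Circle2Pi → ℂ)
    (hf : ∀ x, HasSum (fun i => a i * EE (ν i) x) (f x)) (k : ℤ) :
    HasSum (fun i => if ν i = k then a i else 0) (fourierCoeff f k) := by
  have h := hasSum_integral_of_summable_integral_norm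
    (μ := (haarAddCircle : Measure Circle2Pi)) (F := fun i x => a i * EE (ν i - k) x)
    (fun i => cont_integrable (continuous_const.mul (EE_cont _))) (by
      simpa [EE_norm] using ha)
  have e1 : (fun i => ∫ x, a i * EE (ν i - k) x ∂(haarAddCircle : Measure Circle2Pi)) =
      fun i => if ν i = k then a i else 0 := by
    funext i
    rw [integral_const_mul, EE_integral]
    simp [sub_eq_zero]
  rw [e1] at h
  have e2 : fourierCoeff f k =
      ∫ x, ∑' i, a i * EE (ν i - k) x ∂(haarAddCircle : Measure Circle2Pi) := by
    unfold fourierCoeff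
    congr 1
    funext x
    have := (hf x).mul_left (EE (-k) x)
    rw [show (fourier (-k) x : ℂ) • f x = EE (-k) x * f x from rfl, ← this.tsum_eq]
    congr 1
    funext i
    rw [sub_eq_add_neg, EE_add]; ring
  rw [e2]
  exact h

lemma rep_mem {ι : Type*} [Countable ι] (a : ι → ℂ) (ν : ι → ℤ)
    (ha : Summable fun i => ‖a i‖) (f : Circle2Pi → ℂ)
    (hf : ∀ x, HasSum (fun i => a i * EE (ν i) x) (f x)) :
    MemFourierAlg f ∧ fourierAlgNorm f ≤ ∑' i, ‖a i‖ := by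
  have hs : ∀ k, Summable fun i => ‖(if ν i = k then a i else 0 : ℂ)‖ := fun k =>
    ha.of_nonneg_of_le (fun i => norm_nonneg _) (fun i => by split_ifs <;> simp)
  have hb : ∀ s : Finset ℤ, ∑ k ∈ s, ‖fourierCoeff f k‖ ≤ ∑' i, ‖a i‖ := by
    intro s
    calc ∑ k ∈ s, ‖fourierCoeff f k‖ ≤ ∑ k ∈ s, ∑' i, ‖(if ν i = k then a i else 0 : ℂ)‖ := by
          refine Finset.sum_le_sum fun k _ => ?_
          rw [← (rep_coeff a ν ha f hf k).tsum_eq]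
          exact norm_tsum_le_tsum_norm (hs k)
      _ = ∑' i, ∑ k ∈ s, ‖(if ν i = k then a i else 0 : ℂ)‖ :=
          (Summable.tsum_finsetSum fun k _ => hs k).symm
      _ ≤ ∑' i, ‖a i‖ := by
          refine Summable.tsum_le_tsum (fun i => ?_) (summable_sum fun k _ => hs k) ha
          have : ∀ k, ‖(if ν i = k then a i else 0 : ℂ)‖ = if ν i = k then ‖a i‖ else 0 := by
            intro k; split_ifs <;> simp
          simp only [this, Finset.sum_ite_eq]
          split_ifs <;> simp
  refine ⟨⟨?_, summable_of_sum_le (fun k => norm_nonneg _) hb⟩,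
    Real.tsum_le_of_sum_le (fun k => norm_nonneg _) hb⟩
  have : f = fun x => ∑' i, a i * EE (ν i) x := funext fun x => (hf x).tsum_eq.symm
  rw [this]
  exact continuous_tsum (fun i => continuous_const.mul (EE_cont _)) ha
    (fun i x => by simp [EE_norm])

lemma mem_hasSum {f : Circle2Pi → ℂ} (hf : MemFourierAlg f) (x : Circle2Pi) :
    HasSum (fun n => fourierCoeff f n * EE n x) (f x) :=
  has_pointwise_sum_fourier_series_of_summable (f := ⟨f, hf.1⟩) hf.2.of_norm x

lemma algNorm_nonneg (f : Circle2Pi → ℂ) : 0 ≤ fourierAlgNorm f :=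
  tsum_nonneg fun _ => norm_nonneg _

lemma functional_hasSum {ι : Type*} [Countable ι] (L : (Circle2Pi → ℂ) →ₗ[ℂ] ℂ) (M : ℝ)
    (hL : ∀ f, MemFourierAlg f → ‖L f‖ ≤ M * fourierAlgNorm f) (a : ι → ℂ) (ν : ι → ℤ)
    (ha : Summable fun i => ‖a i‖) (f : Circle2Pi → ℂ)
    (hf : ∀ x, HasSum (fun i => a i * EE (ν i) x) (f x)) :
    HasSum (fun i => a i * L (EE (ν i))) (L f) := by
  have key : ∀ s : Finset ι, ‖L f - ∑ i ∈ s, a i * L (EE (ν i))‖ ≤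
      |M| * ∑' i : {i // i ∉ s}, ‖a i‖ := by
    intro s
    have e : L f - ∑ i ∈ s, a i * L (EE (ν i)) = L (f - ∑ i ∈ s, a i • EE (ν i)) := by
      simp [map_sub, map_sum]
    rw [e]
    have r := rep_mem (fun i : {i // i ∉ s} => a i) (fun i => ν i)
      (ha.subtype _) (f - ∑ i ∈ s, a i • EE (ν i)) (by
        intro x
        have := (Finset.hasSum_compl_iff (f := fun i => a i * EE (ν i) x) s
          (a := f x - ∑ i ∈ s, a i * EE (ν i) x)).2 (by simpa using hf x)
        simpa [Finset.sum_apply] using this)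
    refine (hL _ r.1).trans ?_
    exact mul_le_mul (le_abs_self M) r.2 (algNorm_nonneg _) (abs_nonneg _)
  have t : Filter.Tendsto (fun s : Finset ι => |M| * ∑' i : {i // i ∉ s}, ‖a i‖)
      Filter.atTop (nhds 0) := by
    simpa using (tendsto_tsum_compl_atTop_zero fun i => ‖a i‖).const_mul |M|
  have t2 := squeeze_zero_norm key t
  have t3 := (tendsto_const_nhds (x := L f)).sub t2
  simpa [HasSum] using t3

lemma EE_hasSum (n : ℤ) (x : Circle2Pi) :
    HasSum (fun _ : Unit => (1 : ℂ) * EE n x) (EE n x) := by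
  simp

lemma EE_mem (n : ℤ) : MemFourierAlg (EE n) :=
  (rep_mem (fun _ : Unit => (1 : ℂ)) (fun _ => n) (Summable.of_finite) _ (EE_hasSum n)).1

lemma EE_algNorm (n : ℤ) : fourierAlgNorm (EE n) ≤ 1 := by
  simpa using
  (rep_mem (fun _ : Unit => (1 : ℂ)) (fun _ => n) (Summable.of_finite) _ (EE_hasSum n)).2

lemma functional_bound (L : (Circle2Pi → ℂ) →ₗ[ℂ] ℂ) (M C : ℝ)
    (hL : ∀ f, MemFourierAlg f → ‖L f‖ ≤ M * fourierAlgNorm f)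
    (hC : ∀ n, ‖L (EE n)‖ ≤ C) (f : Circle2Pi → ℂ) (hf : MemFourierAlg f) :
    ‖L f‖ ≤ C * fourierAlgNorm f := by
  have h := functional_hasSum L M hL _ (fun n => n) hf.2 f (mem_hasSum hf)
  rw [← h.tsum_eq, fourierAlgNorm, ← tsum_mul_left]
  refine tsum_of_norm_bounded (hf.2.mul_left C).hasSum fun n => ?_
  rw [norm_mul, mul_comm]
  exact mul_le_mul_of_nonneg_right (hC n) (norm_nonneg _)

lemma mul_mem {f g : Circle2Pi → ℂ} (hf : MemFourierAlg f) (hg : MemFourierAlg g) :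
    MemFourierAlg (fun s => f s * g s) ∧
      fourierAlgNorm (fun s => f s * g s) ≤ fourierAlgNorm f * fourierAlgNorm g := by
  have hs : Summable fun p : ℤ × ℤ => ‖fourierCoeff f p.1 * fourierCoeff g p.2‖ :=
    hf.2.mul_norm hg.2
  have r := rep_mem (fun p : ℤ × ℤ => fourierCoeff f p.1 * fourierCoeff g p.2)
    (fun p => p.1 + p.2) hs (fun s => f s * g s) (by
      intro x
      have s1 : Summable fun n => ‖fourierCoeff f n * EE n x‖ := by simpa [EE_norm] using hf.2
      have s2 : Summable fun n => ‖fourierCoeff g n * EE n x‖ := by simpa [EE_norm] using hg.2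
      have h3 := (summable_mul_of_summable_norm s1 s2).hasSum
      rw [← tsum_mul_tsum_of_summable_norm s1 s2, (mem_hasSum hf x).tsum_eq,
        (mem_hasSum hg x).tsum_eq] at h3
      refine h3.congr_fun ?_
      intro p
      rw [EE_add]; ring)
  refine ⟨r.1, r.2.trans (le_of_eq ?_)⟩
  rw [fourierAlgNorm, fourierAlgNorm, tsum_mul_tsum_of_summable_norm (by simpa using hf.2) (by simpa using hg.2)]
  simp

/-- Triangle function. -/
def tri (a : ℝ) : Circle2Pi → ℂ := fun x => ((max 0 (1 - ‖x‖ / a) : ℝ) : ℂ)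

/-- Its Fourier coefficients. -/
def tc (a : ℝ) (n : ℤ) : ℝ :=
  if n = 0 then a / (2 * Real.pi) else (1 - Real.cos (n * a)) / (Real.pi * a * (n : ℝ) ^ 2)

lemma tri_cont (a : ℝ) : Continuous (tri a) := by
  unfold tri
  fun_prop

lemma tri_integral (a : ℝ) (ha : 0 < a) (haπ : a ≤ Real.pi) (n : ℤ) :
    fourierCoeff (tri a) n = (1 / (2 * Real.pi) : ℝ) •
      ((∫ t in (-a)..0, Complex.exp (-(n * t * Complex.I)) * (1 + t / a)) +
       ∫ t in (0:ℝ)..a, Complex.exp (-(n * t * Complex.I)) * (1 - t / a)) := by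
  have hpi := Real.pi_pos
  rw [fourierCoeff_eq_intervalIntegral _ _ (-Real.pi)]
  congr 1
  set F : ℝ → ℂ := fun t => Complex.exp (-(n * t * Complex.I)) * ((max 0 (1 - |t| / a) : ℝ) : ℂ)
    with hF
  have hFc : Continuous F := by rw [hF]; fun_prop
  have hi : ∀ p q : ℝ, IntervalIntegrable F volume p q := fun p q => hFc.intervalIntegrable p q
  have e0 : ∫ x in (-Real.pi)..(-Real.pi + 2 * Real.pi), fourier (-n) (x : Circle2Pi) • tri a x
      = ∫ x in (-Real.pi)..Real.pi, F x := by
    rw [show -Real.pi + 2 * Real.pi = Real.pi by ring]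
    refine intervalIntegral.integral_congr fun x hx => ?_
    rw [Set.uIcc_of_le (by linarith)] at hx
    have hn : ‖(x : Circle2Pi)‖ = |x| := by
      rw [AddCircle.norm_coe_eq_abs_iff _ (by positivity)]
      rw [abs_of_pos (by positivity : (0:ℝ) < 2 * Real.pi)]
      rw [abs_le]; constructor <;> linarith [hx.1, hx.2]
    simp only [hF, tri, smul_eq_mul, hn, fourier_coe_apply]
    congr 2
    push_cast
    have : (Real.pi : ℂ) ≠ 0 := by exact_mod_cast hpi.ne'
    field_simp
  rw [e0]
  have z1 : ∫ x in (-Real.pi)..(-a), F x = 0 := by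
    rw [intervalIntegral.integral_congr (g := fun _ => (0:ℂ))]
    · simp
    · intro x hx
      rw [Set.uIcc_of_le (by linarith)] at hx
      have : 1 ≤ |x| / a := by
        rw [le_div_iff₀ ha, abs_of_nonpos (by linarith [hx.2])]; linarith [hx.2]
      simp only [hF]
      rw [max_eq_left (by linarith)]; simp
  have z2 : ∫ x in a..Real.pi, F x = 0 := by
    rw [intervalIntegral.integral_congr (g := fun _ => (0:ℂ))]
    · simp
    · intro x hx
      rw [Set.uIcc_of_le (by linarith)] at hx
      have : 1 ≤ |x| / a := by
        rw [le_div_iff₀ ha, abs_of_nonneg (by linarith [hx.1])]; linarith [hx.1]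
      simp only [hF]
      rw [max_eq_left (by linarith)]; simp
  rw [← intervalIntegral.integral_add_adjacent_intervals (hi _ (-a)) (hi _ _),
    ← intervalIntegral.integral_add_adjacent_intervals (hi (-a) 0) (hi _ _),
    ← intervalIntegral.integral_add_adjacent_intervals (hi 0 a) (hi _ _), z1, z2, zero_add, add_zero]
  congr 1
  · refine intervalIntegral.integral_congr fun x hx => ?_
    rw [Set.uIcc_of_le (by linarith)] at hx
    have : |x| / a ≤ 1 := by
      rw [div_le_one ha, abs_of_nonpos (by linarith [hx.2])]; linarith [hx.1]
    simp only [hF]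
    rw [max_eq_right (by linarith), abs_of_nonpos (by linarith [hx.2])]; push_cast; ring
  · refine intervalIntegral.integral_congr fun x hx => ?_
    rw [Set.uIcc_of_le (by linarith)] at hx
    have : |x| / a ≤ 1 := by
      rw [div_le_one ha, abs_of_nonneg (by linarith [hx.1])]; linarith [hx.2]
    simp only [hF]
    rw [max_eq_right (by linarith), abs_of_nonneg (by linarith [hx.1])]; push_cast; ring

lemma tri_prim (n : ℤ) (hn : n ≠ 0) (σ p q : ℝ) :
    ∫ t in p..q, Complex.exp (-(n * t * Complex.I)) * (1 + σ * t) =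
      Complex.exp (-(n * q * Complex.I)) * ((1 + σ * q) * Complex.I / n + σ / n ^ 2) -
      Complex.exp (-(n * p * Complex.I)) * ((1 + σ * p) * Complex.I / n + σ / n ^ 2) := by
  have hn' : (n : ℂ) ≠ 0 := by exact_mod_cast hn
  refine intervalIntegral.integral_eq_sub_of_hasDerivAt
    (f := fun t : ℝ => Complex.exp (-(n * t * Complex.I)) *
      ((1 + σ * t) * Complex.I / n + σ / n ^ 2)) (fun t _ => ?_) ?_
  · have h0 : HasDerivAt (fun t : ℝ => (t : ℂ)) 1 t := Complex.ofRealCLM.hasDerivAt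
    have h1 : HasDerivAt (fun t : ℝ => Complex.exp (-(n * t * Complex.I))) 
       (Complex.exp (-(n * t * Complex.I)) * (-(n * 1 * Complex.I))) t :=
      (((h0.const_mul (n:ℂ)).mul_const Complex.I).neg).cexp
    have h2 : HasDerivAt (fun t : ℝ => ((1 + σ * t) * Complex.I / n + σ / n ^ 2 : ℂ))
      (σ * 1 * Complex.I / n) t :=
      (((((h0.const_mul (σ:ℂ)).const_add 1).mul_const Complex.I).div_const (n:ℂ)).add_const _)
    convert! h1.mul h2 using 1
    field_simp
    ring_nf
    simp only [Complex.I_sq]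
    ring
  · apply Continuous.intervalIntegrable
    fun_prop

lemma tri_coeff (a : ℝ) (ha : 0 < a) (haπ : a ≤ Real.pi) (n : ℤ) :
    fourierCoeff (tri a) n = (tc a n : ℂ) := by
  have hpi := Real.pi_pos
  have hpi' : (Real.pi : ℂ) ≠ 0 := by exact_mod_cast hpi.ne'
  have ha' : (a : ℂ) ≠ 0 := by exact_mod_cast ha.ne'
  rw [tri_integral a ha haπ n]
  by_cases hn : n = 0
  · subst hn
    have i1 : ∫ t in (-a)..0, ((1:ℂ) + t / a) = (a / 2 : ℝ) := by
      rw [show (∫ t in (-a)..0, ((1:ℂ) + t / a)) = ∫ t in (-a)..0, ((1 + t / a : ℝ) : ℂ) by simp,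
        intervalIntegral.integral_ofReal]
      congr 1
      rw [intervalIntegral.integral_add (by simp) (by apply Continuous.intervalIntegrable; fun_prop),
        intervalIntegral.integral_div]
      simp
      field_simp; ring
    have i2 : ∫ t in (0:ℝ)..a, ((1:ℂ) - t / a) = (a / 2 : ℝ) := by
      rw [show (∫ t in (0:ℝ)..a, ((1:ℂ) - t / a)) = ∫ t in (0:ℝ)..a, ((1 - t / a : ℝ) : ℂ) by simp,
        intervalIntegral.integral_ofReal]
      congr 1
      rw [intervalIntegral.integral_sub (by simp) (by apply Continuous.intervalIntegrable; fun_prop),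
        intervalIntegral.integral_div]
      simp
      field_simp; ring
    simp only [Int.cast_zero, zero_mul, neg_zero, Complex.exp_zero, one_mul, i1, i2, tc, if_true, Complex.real_smul]
    push_cast
    field_simp
    try ring
  · have hn' : (n : ℂ) ≠ 0 := by exact_mod_cast hn
    have j1 := tri_prim n hn (1 / a) (-a) 0
    have j2 := tri_prim n hn (-1 / a) 0 a
    have k1 : ∫ t in (-a)..0, Complex.exp (-(n * t * Complex.I)) * (1 + t / a) =
      ∫ t in (-a)..0, Complex.exp (-(n * t * Complex.I)) * (1 + (1 / a : ℝ) * t) := by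
      congr 1; funext t; push_cast; ring
    have k2 : ∫ t in (0:ℝ)..a, Complex.exp (-(n * t * Complex.I)) * (1 - t / a) =
      ∫ t in (0:ℝ)..a, Complex.exp (-(n * t * Complex.I)) * (1 + (-1 / a : ℝ) * t) := by
      congr 1; funext t; push_cast; ring
    rw [k1, k2, j1, j2]
    simp only [tc, hn, if_false]
    push_cast
    rw [Complex.cos]
    simp only [Complex.real_smul]
    push_cast
    rw [show -((n:ℂ) * -a * Complex.I) = n * a * Complex.I by ring,
      show -((n:ℂ) * a) * Complex.I = -(n * a * Complex.I) by ring]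
    simp only [mul_zero, zero_mul, neg_zero, Complex.exp_zero]
    field_simp
    ring

lemma tc_nonneg (a : ℝ) (ha : 0 < a) (n : ℤ) : 0 ≤ tc a n := by
  have hpi := Real.pi_pos
  unfold tc
  split_ifs
  · positivity
  · have := Real.cos_le_one (n * a)
    apply div_nonneg (by linarith) (by positivity)

lemma tc_even (a : ℝ) (n : ℤ) : tc a (-n) = tc a n := by
  simp [tc]

lemma tc_summable (a : ℝ) (ha : 0 < a) : Summable (tc a) := by
  have hpi := Real.pi_pos
  have h : Summable fun n : ℤ => (2 / (Real.pi * a)) * (1 / (n : ℝ) ^ 2) :=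
    (Real.summable_one_div_int_pow.2 (by norm_num : 1 < 2)).mul_left _
  have h2 : Summable fun n : ℤ => (if n = 0 then a / (2 * Real.pi) else 0 : ℝ) :=
    (hasSum_ite_eq (0 : ℤ) _).summable
  refine (h.add h2).of_nonneg_of_le (tc_nonneg a ha) fun n => ?_
  unfold tc
  split_ifs with hn
  · subst hn; simp
  · have := Real.neg_one_le_cos (n * a)
    have hn' : (n : ℝ) ≠ 0 := by exact_mod_cast hn
    rw [add_zero, div_mul_div_comm, mul_one]
    gcongr
    linarith

lemma tri_mem (a : ℝ) (ha : 0 < a) (haπ : a ≤ Real.pi) : MemFourierAlg (tri a) := by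
  refine ⟨tri_cont a, ?_⟩
  simpa [tri_coeff a ha haπ] using (tc_summable a ha).norm

lemma tc_hasSum (a : ℝ) (ha : 0 < a) (haπ : a ≤ Real.pi) : HasSum (tc a) 1 := by
  have h := mem_hasSum (tri_mem a ha haπ) 0
  simp only [tri_coeff a ha haπ, EE, fourier_eval_zero, mul_one, tri, norm_zero, zero_div,
    sub_zero] at h
  rw [max_eq_right zero_le_one] at h
  exact_mod_cast h

lemma parseval (f : Circle2Pi → ℂ) (hf : Continuous f) :
    HasSum (fun n => ‖fourierCoeff f n‖ ^ 2) (∫ x, ‖f x‖ ^ 2 ∂(haarAddCircle : Measure Circle2Pi)) := by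
  have hm : MemLp f 2 (haarAddCircle : Measure Circle2Pi) :=
    hf.memLp_of_hasCompactSupport (HasCompactSupport.of_compactSpace f)
  have h := hasSum_sq_fourierCoeff hm.toLp
  rw [fourierCoeff_congr_ae hm.coeFn_toLp] at h
  convert h using 1
  apply integral_congr_ae
  filter_upwards [hm.coeFn_toLp] with x hx
  rw [hx]

lemma cauchy_schwarz {X Y : ℤ → ℝ} (hX : ∀ i, 0 ≤ X i) (hY : ∀ i, 0 ≤ Y i) {A B : ℝ}
    (hA : Summable fun i => X i ^ 2) (hA' : ∑' i, X i ^ 2 ≤ A)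
    (hB : Summable fun i => Y i ^ 2) (hB' : ∑' i, Y i ^ 2 ≤ B) :
    Summable (fun i => X i * Y i) ∧ ∑' i, X i * Y i ≤ √A * √B := by
  have h : ∀ s : Finset ℤ, ∑ i ∈ s, X i * Y i ≤ √A * √B := by
    intro s
    refine (Real.sum_mul_le_sqrt_mul_sqrt s X Y).trans ?_
    gcongr
    · exact (hA.sum_le_tsum s fun i _ => sq_nonneg _).trans hA'
    · exact (hB.sum_le_tsum s fun i _ => sq_nonneg _).trans hB'
  have h0 : ∀ i, 0 ≤ X i * Y i := fun i => mul_nonneg (hX i) (hY i)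
  exact ⟨summable_of_sum_le h0 h, Real.tsum_le_of_sum_le h0 h⟩

lemma EE_one_sub (x : Circle2Pi) : ‖EE 1 x - 1‖ ≤ ‖x‖ := by
  have hpi := Real.pi_pos
  have hx : x ∈ ((↑) '' Set.Icc (-Real.pi) (-Real.pi + 2 * Real.pi) : Set Circle2Pi) := by
    rw [AddCircle.coe_image_Icc_eq]; trivial
  obtain ⟨t, ht, rfl⟩ := hx
  have hn : ‖(t : Circle2Pi)‖ = |t| := by
    rw [AddCircle.norm_coe_eq_abs_iff _ (by positivity)]
    rw [abs_of_pos (by positivity : (0:ℝ) < 2 * Real.pi)]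
    rw [abs_le]; constructor <;> linarith [ht.1, ht.2]
  rw [hn]
  have := Real.norm_exp_I_mul_ofReal_sub_one_le (x := t)
  rw [Real.norm_eq_abs] at this
  convert this using 3
  simp only [EE, fourier_coe_apply]
  congr 1
  have : (Real.pi : ℂ) ≠ 0 := by exact_mod_cast hpi.ne'
  push_cast
  field_simp

lemma sq_bound (f : Circle2Pi → ℝ) (hf : Continuous f) (H I r : ℝ)
    (h0 : ∀ x, 0 ≤ f x) (hH : ∀ x, f x ≤ H) (hr : ∀ x, r < ‖x‖ → f x = 0) (hr0 : 0 ≤ r)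
    (hI : fourierCoeff (fun x => (f x : ℂ)) 0 = (I : ℂ)) :
    (Summable fun m => ‖fourierCoeff (fun x => (f x : ℂ)) m‖ ^ 2) ∧
    (∑' m, ‖fourierCoeff (fun x => (f x : ℂ)) m‖ ^ 2 ≤ H * I) ∧
    (Summable fun m => ‖fourierCoeff (fun x => (f x : ℂ)) (m - 1) -
        fourierCoeff (fun x => (f x : ℂ)) m‖ ^ 2) ∧
    (∑' m, ‖fourierCoeff (fun x => (f x : ℂ)) (m - 1) -
        fourierCoeff (fun x => (f x : ℂ)) m‖ ^ 2 ≤ r ^ 2 * (H * I)) := by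
  set F : Circle2Pi → ℂ := fun x => (f x : ℂ) with hF
  have hFc : Continuous F := by rw [hF]; fun_prop
  have hint : ∀ g : Circle2Pi → ℝ, Continuous g →
      Integrable g (haarAddCircle : Measure Circle2Pi) := fun g hg =>
    hg.integrable_of_hasCompactSupport (HasCompactSupport.of_compactSpace g)
  have hI' : ∫ x, f x ∂(haarAddCircle : Measure Circle2Pi) = I := by
    have : (∫ x, F x ∂(haarAddCircle : Measure Circle2Pi)) = (I : ℂ) := by
      rw [← hI]; simp [fourierCoeff]
    have this : (∫ x, (f x : ℂ) ∂(haarAddCircle : Measure Circle2Pi)) = (I : ℂ) := this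
    rw [integral_complex_ofReal] at this
    exact_mod_cast this
  have p1 := parseval F hFc
  have hG : Continuous fun x => (EE 1 x - 1) * F x :=
    ((EE_cont 1).sub continuous_const).mul hFc
  have p2 := parseval _ hG
  have hco : ∀ m, fourierCoeff (fun x => (EE 1 x - 1) * F x) m =
      fourierCoeff F (m - 1) - fourierCoeff F m := by
    intro m
    unfold fourierCoeff
    rw [← integral_sub]
    · congr 1
      funext x
      have := EE_add (-m) 1 x
      rw [show -m + 1 = -(m - 1) by ring] at this
      simp only [smul_eq_mul, EE] at this ⊢
      rw [this]; ring
    · exact (cont_integrable hFc).fourier_smul _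
    · exact (cont_integrable hFc).fourier_smul _
  simp only [hco] at p2
  have b1 : ∫ x, ‖F x‖ ^ 2 ∂(haarAddCircle : Measure Circle2Pi) ≤ H * I := by
    rw [← hI', ← integral_const_mul]
    refine integral_mono (hint _ (by fun_prop)) (hint _ (by fun_prop)) fun x => ?_
    simp only [hF, Complex.norm_real, Real.norm_eq_abs, sq_abs]
    nlinarith [h0 x, hH x]
  have b2 : ∫ x, ‖(EE 1 x - 1) * F x‖ ^ 2 ∂(haarAddCircle : Measure Circle2Pi) ≤
      r ^ 2 * (H * I) := by
    rw [← hI', ← integral_const_mul, ← integral_const_mul]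
    refine integral_mono (hint _ (by fun_prop)) (hint _ (by fun_prop)) fun x => ?_
    simp only [norm_mul, hF, Complex.norm_real, Real.norm_eq_abs, mul_pow, sq_abs]
    rcases lt_or_ge r ‖x‖ with h | h
    · simp [hr x h]
    · have h1 : ‖EE 1 x - 1‖ ^ 2 ≤ r ^ 2 :=
        pow_le_pow_left₀ (norm_nonneg _) ((EE_one_sub x).trans h) 2
      have h2 : f x ^ 2 ≤ H * f x := by nlinarith [h0 x, hH x]
      exact mul_le_mul h1 h2 (sq_nonneg _) (sq_nonneg _)
  exact ⟨p1.summable, p1.tsum_eq.trans_le b1, p2.summable, p2.tsum_eq.trans_le b2⟩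

lemma comp_rep {c : Circle2Pi → ℂ} (hc : MemFourierAlg c) (n p : ℤ) (θ x : Circle2Pi) :
    HasSum (fun m => (fourierCoeff c m * EE m θ) * EE (n * m + p) x) (EE p x * c (n • x + θ)) := by
  refine ((mem_hasSum hc (n • x + θ)).mul_left (EE p x)).congr_fun ?_
  intro m
  rw [EE_add_arg, EE_zsmul, EE_add]; ring

lemma shift_bound (φ : (Circle2Pi → ℂ) →ₗ[ℂ] (Circle2Pi → ℂ) →ₗ[ℂ] ℂ)
    (hφnorm : ∀ f g : Circle2Pi → ℂ, MemFourierAlg f → MemFourierAlg g →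
      ‖φ f g‖ ≤ fourierAlgNorm f * fourierAlgNorm g)
    (α : ℝ) (hα0 : 0 ≤ α)
    (hdisj : ∀ f g : Circle2Pi → ℂ, MemFourierAlg f → MemFourierAlg g →
      tsupport f ∩ tsupport g = ∅ →
      ‖φ f g‖ ≤ α * fourierAlgNorm f * fourierAlgNorm g)
    (c d : Circle2Pi → ℂ) (hc : MemFourierAlg c) (hd : MemFourierAlg d)
    (hcd : tsupport c ∩ tsupport d = ∅) (n p q : ℤ) :
    ‖∑' m, fourierCoeff c m * fourierCoeff d (-m) * φ (EE (n * m + p)) (EE (n * (-m) + q))‖ ≤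
      α * fourierAlgNorm c * fourierAlgNorm d := by
  set A : ℤ × ℤ → ℂ := fun z => fourierCoeff c z.1 * fourierCoeff d z.2 *
    φ (EE (n * z.1 + p)) (EE (n * z.2 + q)) with hA
  have hu : ∀ m l, ‖φ (EE m) (EE l)‖ ≤ 1 := fun m l => by
    refine (hφnorm _ _ (EE_mem m) (EE_mem l)).trans ?_
    exact mul_le_one₀ (EE_algNorm m) (algNorm_nonneg _) (EE_algNorm l)
  have hAs : Summable fun z => ‖A z‖ := by
    refine (hc.2.mul_norm hd.2).of_nonneg_of_le (fun _ => norm_nonneg _) fun z => ?_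
    rw [hA, norm_mul]
    refine mul_le_of_le_one_right (norm_nonneg _) (hu _ _)
  set F : Circle2Pi → Circle2Pi → ℂ := fun θ x => EE p x * c (n • x + θ) with hF
  set G : Circle2Pi → Circle2Pi → ℂ := fun θ x => EE q x * d (n • x + θ) with hG
  have nc : ∀ θ, Summable fun m => ‖fourierCoeff c m * EE m θ‖ := fun θ => by
    simpa [EE_norm] using hc.2
  have nd : ∀ θ, Summable fun m => ‖fourierCoeff d m * EE m θ‖ := fun θ => by
    simpa [EE_norm] using hd.2
  have mF : ∀ θ, MemFourierAlg (F θ) ∧ fourierAlgNorm (F θ) ≤ fourierAlgNorm c := fun θ => by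
    have := rep_mem _ _ (nc θ) (F θ) (comp_rep hc n p θ)
    simpa [EE_norm, fourierAlgNorm] using this
  have mG : ∀ θ, MemFourierAlg (G θ) ∧ fourierAlgNorm (G θ) ≤ fourierAlgNorm d := fun θ => by
    have := rep_mem _ _ (nd θ) (G θ) (comp_rep hd n q θ)
    simpa [EE_norm, fourierAlgNorm] using this
  have hsum : ∀ θ, HasSum (fun z => A z * EE (z.1 + z.2) θ) (φ (F θ) (G θ)) := by
    intro θ
    have s : Summable fun z => A z * EE (z.1 + z.2) θ := by
      apply Summable.of_norm
      simpa [EE_norm] using hAs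
    have e1 := functional_hasSum (φ.flip (G θ)) (fourierAlgNorm (G θ))
      (fun f hf => by
        rw [mul_comm]; exact hφnorm f _ hf (mG θ).1) _ _ (nc θ) (F θ) (comp_rep hc n p θ)
    have e2 : ∀ m, HasSum (fun l => A (m, l) * EE (m + l) θ)
        (fourierCoeff c m * EE m θ * φ (EE (n * m + p)) (G θ)) := by
      intro m
      have := functional_hasSum (φ (EE (n * m + p))) (fourierAlgNorm (EE (n * m + p)))
        (fun f hf => hφnorm _ f (EE_mem _) hf) _ _ (nd θ) (G θ) (comp_rep hd n q θ)
      refine (this.mul_left (fourierCoeff c m * EE m θ)).congr_fun ?_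
      intro l
      simp only [hA, EE_add]; ring
    have e3 := s.hasSum.prod_fiberwise e2
    have e4 := e1.unique e3
    simp only [LinearMap.flip_apply] at e4
    rw [e4]
    exact s.hasSum
  have hco := rep_coeff A (fun z => z.1 + z.2) hAs (fun θ => φ (F θ) (G θ)) hsum 0
  have e5 : ∑' m, fourierCoeff c m * fourierCoeff d (-m) *
      φ (EE (n * m + p)) (EE (n * (-m) + q)) =
      fourierCoeff (fun θ => φ (F θ) (G θ)) 0 := by
    refine (hco.prod_fiberwise (g := fun m => A (m, -m)) fun m => ?_).tsum_eq
    have : (fun l => if m + l = 0 then A (m, l) else 0) =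
        fun l => if l = -m then A (m, -m) else 0 := by
      funext l
      by_cases h : l = -m
      · subst h; simp
      · rw [if_neg h, if_neg (by omega)]
    rw [this]
    exact hasSum_ite_eq (-m) _
  rw [e5]
  simp only [fourierCoeff, neg_zero, fourier_zero, one_smul]
  refine (norm_integral_le_of_norm_le_const (C := α * fourierAlgNorm c * fourierAlgNorm d)
    (Filter.Eventually.of_forall fun θ => ?_)).trans (by simp)
  have hsupp : ∀ (w : Circle2Pi → ℂ) (r : ℤ),
      tsupport (fun x => EE r x * w (n • x + θ)) ⊆ (fun x => n • x + θ) ⁻¹' tsupport w := by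
    intro w r
    refine closure_minimal ?_ ((isClosed_tsupport w).preimage (by fun_prop))
    intro x hx
    apply subset_tsupport
    intro h
    apply hx
    simp only [h, mul_zero]
  refine (hdisj _ _ (mF θ).1 (mG θ).1 ?_).trans ?_
  · rw [Set.eq_empty_iff_forall_notMem]
    rintro x ⟨h1, h2⟩
    have : n • x + θ ∈ tsupport c ∩ tsupport d := ⟨hsupp c p h1, hsupp d q h2⟩
    rw [hcd] at this
    exact this
  · have h1 := (mF θ).2
    have h2 := (mG θ).2
    have := algNorm_nonneg (F θ)
    have := algNorm_nonneg (G θ)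
    have := algNorm_nonneg c
    gcongr

/-- Fourier coefficients of the normalized bump. -/
def cc (a : ℝ) (m : ℤ) : ℝ := (2 * Real.pi / a) * tc a m

/-- Fourier coefficients of the trapezoid. -/
def kk (b : ℝ) (m : ℤ) : ℝ := 2 * tc (2 * b) m - tc b m

/-- Normalized bump. -/
def fc (a : ℝ) : Circle2Pi → ℝ := fun x => (2 * Real.pi / a) * max 0 (1 - ‖x‖ / a)

/-- Trapezoid. -/
def fk (b : ℝ) : Circle2Pi → ℝ := fun x =>
  2 * max 0 (1 - ‖x‖ / (2 * b)) - max 0 (1 - ‖x‖ / b)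

lemma fc_coeff (a : ℝ) (ha : 0 < a) (haπ : a ≤ Real.pi) (m : ℤ) :
    fourierCoeff (fun x => (fc a x : ℂ)) m = (cc a m : ℂ) := by
  have : (fun x => (fc a x : ℂ)) = fun x => ((2 * Real.pi / a : ℝ) : ℂ) * tri a x := by
    funext x; simp [fc, tri]
  rw [this, fourierCoeff.const_mul, tri_coeff a ha haπ, cc]
  push_cast; ring

lemma coeff_sub {f g : Circle2Pi → ℂ} (hf : Continuous f) (hg : Continuous g) (m : ℤ) :
    fourierCoeff (fun x => f x - g x) m = fourierCoeff f m - fourierCoeff g m := by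
  unfold fourierCoeff
  rw [← integral_sub ((cont_integrable hf).fourier_smul _) ((cont_integrable hg).fourier_smul _)]
  congr 1
  funext x
  simp only [smul_eq_mul]; ring

lemma fk_coeff (b : ℝ) (hb : 0 < b) (hbπ : 2 * b ≤ Real.pi) (m : ℤ) :
    fourierCoeff (fun x => (fk b x : ℂ)) m = (kk b m : ℂ) := by
  have : (fun x => (fk b x : ℂ)) = fun x => (2 : ℂ) * tri (2 * b) x - tri b x := by
    funext x; simp [fk, tri]
  have hcm : Continuous fun x => (2 : ℂ) * tri (2 * b) x := continuous_const.mul (tri_cont _)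
  rw [this, coeff_sub hcm (tri_cont _), fourierCoeff.const_mul,
    tri_coeff _ (by linarith) hbπ, tri_coeff b hb (by linarith), kk]
  push_cast; ring

lemma fc_cont (a : ℝ) : Continuous (fc a) := by unfold fc; fun_prop
lemma fk_cont (b : ℝ) : Continuous (fk b) := by unfold fk; fun_prop

lemma cc_hasSum (a : ℝ) (ha : 0 < a) (haπ : a ≤ Real.pi) : HasSum (cc a) (2 * Real.pi / a) := by
  have := (tc_hasSum a ha haπ).mul_left (2 * Real.pi / a)
  rw [mul_one] at this
  exact this

lemma cc_nonneg (a : ℝ) (ha : 0 < a) (m : ℤ) : 0 ≤ cc a m := by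
  have := tc_nonneg a ha m
  have := Real.pi_pos
  unfold cc; positivity

lemma cc_zero (a : ℝ) (ha : 0 < a) : cc a 0 = 1 := by
  have := Real.pi_pos
  simp only [cc, tc, if_true]; field_simp

lemma kk_zero (b : ℝ) : kk b 0 = 3 * b / (2 * Real.pi) := by
  simp [kk, tc]; ring

lemma kk_even (b : ℝ) (m : ℤ) : kk b (-m) = kk b m := by simp [kk, tc_even]

lemma fk_cases (b : ℝ) (hb : 0 < b) (x : Circle2Pi) :
    0 ≤ fk b x ∧ fk b x ≤ 1 ∧ (2 * b < ‖x‖ → fk b x = 0) ∧ (‖x‖ ≤ b → fk b x = 1) := by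
  have e1 : ‖x‖ / b = 2 * (‖x‖ / (2 * b)) := by field_simp
  set y := ‖x‖ / (2 * b) with hy
  have h1 : 2 * b < ‖x‖ → 1 ≤ y := fun h => by rw [hy, le_div_iff₀ (by linarith)]; linarith
  have h2 : ‖x‖ ≤ b → 2 * y ≤ 1 := fun h => by rw [← e1, div_le_one hb]; exact h
  have h3 : 0 ≤ y := by positivity
  unfold fk
  rw [e1, ← hy]
  refine ⟨?_, ?_, fun h => ?_, fun h => ?_⟩
  · rcases max_cases 0 (1 - y) with h | h <;> rcases max_cases 0 (1 - 2 * y) with h' | h' <;> linarith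
  · rcases max_cases 0 (1 - y) with h | h <;> rcases max_cases 0 (1 - 2 * y) with h' | h' <;> linarith
  · have := h1 h
    rw [max_eq_left (by linarith), max_eq_left (by linarith)]; ring
  · have := h2 h
    rw [max_eq_right (by linarith), max_eq_right (by linarith)]; ring

lemma fc_zero (a : ℝ) (ha : 0 < a) (x : Circle2Pi) (h : a < ‖x‖) : fc a x = 0 := by
  have : 1 ≤ ‖x‖ / a := by rw [le_div_iff₀ ha]; linarith
  unfold fc
  rw [max_eq_left (by linarith), mul_zero]

/-- The commutator-type estimate. -/
lemma kdiff (a b : ℝ) (ha : 0 < a) (haπ : a ≤ Real.pi) (hb : 0 < b) (hbπ : 2 * b ≤ Real.pi) :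
    (Summable fun m => |cc a (m - 1) * kk b (m - 1) - cc a m * kk b m|) ∧
    ∑' m, |cc a (m - 1) * kk b (m - 1) - cc a m * kk b m| ≤ (a + 2 * b) * √(3 * b / a) := by
  have hpi := Real.pi_pos
  obtain ⟨c1, c2, c3, c4⟩ := sq_bound (fc a) (fc_cont a) (2 * Real.pi / a) 1 a
    (fun x => by unfold fc; positivity) (fun x => by
      unfold fc
      refine mul_le_of_le_one_right (by positivity) (max_le zero_le_one ?_)
      have : 0 ≤ ‖x‖ / a := by positivity
      linarith) (fc_zero a ha) ha.le (by rw [fc_coeff a ha haπ, cc_zero a ha])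
  obtain ⟨k1, k2, k3, k4⟩ := sq_bound (fk b) (fk_cont b) 1 (3 * b / (2 * Real.pi)) (2 * b)
    (fun x => (fk_cases b hb x).1) (fun x => (fk_cases b hb x).2.1)
    (fun x => (fk_cases b hb x).2.2.1) (by linarith) (by rw [fk_coeff b hb hbπ, kk_zero])
  simp only [fc_coeff a ha haπ, fk_coeff b hb hbπ, ← Complex.ofReal_sub, Complex.norm_real,
    Real.norm_eq_abs, mul_one, one_mul] at c1 c2 c3 c4 k1 k2 k3 k4
  have sh : (Summable fun m => |cc a (m - 1)| ^ 2) ∧ ∑' m, |cc a (m - 1)| ^ 2 ≤ 2 * Real.pi / a := by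
    refine ⟨(Equiv.subRight (1 : ℤ)).summable_iff.2 c1, ?_⟩
    rw [← (Equiv.subRight (1 : ℤ)).tsum_eq] at c2
    simpa using c2
  obtain ⟨s1, t1⟩ := cauchy_schwarz (fun _ => abs_nonneg _) (fun _ => abs_nonneg _)
    sh.1 sh.2 k3 k4
  obtain ⟨s2, t2⟩ := cauchy_schwarz (fun _ => abs_nonneg _) (fun _ => abs_nonneg _)
    c3 c4 k1 k2
  have hle : ∀ m, |cc a (m - 1) * kk b (m - 1) - cc a m * kk b m| ≤
      |cc a (m - 1)| * |kk b (m - 1) - kk b m| + |cc a (m - 1) - cc a m| * |kk b m| := by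
    intro m
    rw [← abs_mul, ← abs_mul]
    refine le_trans (le_of_eq ?_) (abs_add_le _ _)
    congr 1; ring
  have hs := (s1.add s2).of_nonneg_of_le (fun _ => abs_nonneg _) hle
  refine ⟨hs, (hs.tsum_le_tsum hle (s1.add s2)).trans ?_⟩
  rw [s1.tsum_add s2]
  refine (add_le_add t1 t2).trans (le_of_eq ?_)
  rw [Real.sqrt_mul (sq_nonneg _), Real.sqrt_mul (sq_nonneg _), Real.sqrt_sq ha.le,
    Real.sqrt_sq (by linarith)]
  have : √(3 * b / a) = √(2 * Real.pi / a) * √(3 * b / (2 * Real.pi)) := by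
    rw [← Real.sqrt_mul (by positivity)]
    congr 1; field_simp
  rw [this]; ring

lemma core (φ : (Circle2Pi → ℂ) →ₗ[ℂ] (Circle2Pi → ℂ) →ₗ[ℂ] ℂ)
    (hφnorm : ∀ f g : Circle2Pi → ℂ, MemFourierAlg f → MemFourierAlg g →
      ‖φ f g‖ ≤ fourierAlgNorm f * fourierAlgNorm g)
    (α : ℝ) (hα0 : 0 ≤ α)
    (hdisj : ∀ f g : Circle2Pi → ℂ, MemFourierAlg f → MemFourierAlg g →
      tsupport f ∩ tsupport g = ∅ →
      ‖φ f g‖ ≤ α * fourierAlgNorm f * fourierAlgNorm g)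
    (a b : ℝ) (ha : 0 < a) (hab : a < b) (hbπ : 2 * b ≤ Real.pi) (n j k : ℤ) :
    ‖φ (EE (j + n)) (EE k) - φ (EE j) (EE (n + k))‖ ≤
      2 * (α * (2 * Real.pi / a) * 4) + (a + 2 * b) * √(3 * b / a) := by
  have hpi := Real.pi_pos
  have hb : 0 < b := ha.trans hab
  have haπ : a ≤ Real.pi := by linarith
  set c : Circle2Pi → ℂ := fun x => (fc a x : ℂ) with hc
  set d : Circle2Pi → ℂ := fun x => EE 0 x - (fk b x : ℂ) with hd
  set δ : ℤ → ℝ := fun m => if m = 0 then 1 else 0 with hδ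
  have hδs : HasSum δ 1 := hasSum_ite_eq (0 : ℤ) (1 : ℝ)
  have cco : ∀ m, fourierCoeff c m = (cc a m : ℂ) := fc_coeff a ha haπ
  have dco : ∀ m, fourierCoeff d m = ((δ m - kk b m : ℝ) : ℂ) := by
    intro m
    have hkc := fk_cont b
    rw [hd, coeff_sub (EE_cont 0) (by fun_prop), fk_coeff b hb hbπ]
    have := rep_coeff (fun _ : Unit => (1 : ℂ)) (fun _ => 0) Summable.of_finite _ (EE_hasSum 0) m
    have h2 := this.unique (hasSum_fintype _)
    rw [h2]
    by_cases hm : m = 0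
    · subst hm; simp [hδ]
    · simp [hδ, hm, Ne.symm hm]
  have hccs := cc_hasSum a ha haπ
  have mc : MemFourierAlg c := by
    refine ⟨Complex.continuous_ofReal.comp (fc_cont a), ?_⟩
    simpa [cco] using hccs.summable.norm
  have nc : fourierAlgNorm c = 2 * Real.pi / a := by
    rw [fourierAlgNorm, ← hccs.tsum_eq]
    congr 1; funext m
    rw [cco, Complex.norm_real, Real.norm_of_nonneg (cc_nonneg a ha m)]
  have hbound : HasSum (fun m => δ m + (2 * tc (2 * b) m + tc b m)) (1 + (2 * 1 + 1)) :=
    hδs.add (((tc_hasSum (2 * b) (by linarith) hbπ).mul_left 2).add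
      (tc_hasSum b hb (by linarith)))
  have hdle : ∀ m, ‖fourierCoeff d m‖ ≤ δ m + (2 * tc (2 * b) m + tc b m) := by
    intro m
    have h1 := tc_nonneg (2 * b) (by linarith) m
    have h2 := tc_nonneg b hb m
    have h3 : 0 ≤ δ m := by simp only [hδ]; split_ifs <;> norm_num
    rw [dco, Complex.norm_real, Real.norm_eq_abs, kk, abs_le]
    constructor <;> linarith
  have sd : Summable fun m => ‖fourierCoeff d m‖ :=
    hbound.summable.of_nonneg_of_le (fun _ => norm_nonneg _) hdle
  have md : MemFourierAlg d :=
    ⟨(EE_cont 0).sub (Complex.continuous_ofReal.comp (fk_cont b)), sd⟩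
  have nd : fourierAlgNorm d ≤ 4 := by
    have := sd.tsum_le_tsum hdle hbound.summable
    rw [hbound.tsum_eq] at this
    unfold fourierAlgNorm
    linarith
  have hcd : tsupport c ∩ tsupport d = ∅ := by
    have s1 : tsupport c ⊆ {x | ‖x‖ ≤ a} := by
      refine closure_minimal ?_ (isClosed_le continuous_norm continuous_const)
      intro x hx
      by_contra h
      exact hx (by simp [hc, fc_zero a ha x (not_le.1 h)])
    have s2 : tsupport d ⊆ {x | b ≤ ‖x‖} := by
      refine closure_minimal ?_ (isClosed_le continuous_const continuous_norm)
      intro x hx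
      by_contra h
      exact hx (by simp [hd, EE_zero, (fk_cases b hb x).2.2.2 (not_le.1 h).le])
    rw [Set.eq_empty_iff_forall_notMem]
    rintro x ⟨h1, h2⟩
    have h1 := s1 h1
    have h2 := s2 h2
    change ‖x‖ ≤ a at h1
    change b ≤ ‖x‖ at h2
    linarith
  set U : ℤ → ℂ := fun m => φ (EE (n * m + j)) (EE (n * (-m) + (n + k))) with hU
  have hU1 : ∀ m, ‖U m‖ ≤ 1 := fun m => by
    refine (hφnorm _ _ (EE_mem _) (EE_mem _)).trans ?_
    exact mul_le_one₀ (EE_algNorm _) (algNorm_nonneg _) (EE_algNorm _)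
  have hbd : α * fourierAlgNorm c * fourierAlgNorm d ≤ α * (2 * Real.pi / a) * 4 := by
    rw [nc]; gcongr
  have S1 := (shift_bound φ hφnorm α hα0 hdisj c d mc md hcd n (j + n) k).trans hbd
  have S2 := (shift_bound φ hφnorm α hα0 hdisj c d mc md hcd n j (n + k)).trans hbd
  have eU : ∀ m : ℤ, φ (EE (n * m + (j + n))) (EE (n * (-m) + k)) = U (m + 1) := by
    intro m
    simp only [hU]
    rw [show n * m + (j + n) = n * (m + 1) + j by ring,
      show n * (-m) + k = n * (-(m + 1)) + (n + k) by ring]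
  have dneg : ∀ m, fourierCoeff d (-m) = ((δ m - kk b m : ℝ) : ℂ) := by
    intro m
    rw [dco, kk_even]; simp [hδ]
  simp only [eU, cco, dneg] at S1 S2
  -- summability
  have skk : Summable (kk b) := by
    unfold kk
    exact (((tc_hasSum (2 * b) (by linarith) hbπ).mul_left 2).sub
      (tc_hasSum b hb (by linarith))).summable
  obtain ⟨kd1, kd2⟩ := kdiff a b ha haπ hb hbπ
  have hcc1 : ∀ m, cc a m ≤ 2 * Real.pi / a := fun m =>
    le_hasSum hccs m fun i _ => cc_nonneg a ha i
  have gen : ∀ (w : ℤ → ℝ), Summable w → ∀ V : ℤ → ℂ, (∀ m, ‖V m‖ ≤ 1) →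
      Summable fun m => (cc a m : ℂ) * (w m : ℂ) * V m := by
    intro w hw V hV
    refine Summable.of_norm_bounded (hw.norm.mul_left (2 * Real.pi / a)) fun m => ?_
    rw [norm_mul, norm_mul, Complex.norm_real, Complex.norm_real,
      Real.norm_of_nonneg (cc_nonneg a ha m)]
    refine (mul_le_of_le_one_right (by have := cc_nonneg a ha m; positivity) (hV m)).trans ?_
    exact mul_le_mul_of_nonneg_right (hcc1 m) (norm_nonneg _)
  have comb : ∀ V : ℤ → ℂ, (∀ m, ‖V m‖ ≤ 1) →
      V 0 = (∑' m, (cc a m : ℂ) * ((δ m - kk b m : ℝ) : ℂ) * V m) +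
        ∑' m, (cc a m : ℂ) * (kk b m : ℂ) * V m := by
    intro V hV
    have h1 := (gen _ (hδs.summable.sub skk) V hV).hasSum
    have h2 := (gen _ skk V hV).hasSum
    have h3 : HasSum (fun m : ℤ => if m = 0 then V 0 else 0) (V 0) := hasSum_ite_eq (0 : ℤ) (V 0)
    refine h3.unique ((h1.add h2).congr_fun ?_)
    intro m
    by_cases hm : m = 0
    · subst hm; simp [hδ, cc_zero a ha]; ring
    · simp [hδ, hm]
  have C1 := comb (fun m => U (m + 1)) (fun m => hU1 _)
  have C2 := comb U hU1
  have T1 := gen _ skk (fun m => U (m + 1)) (fun m => hU1 _)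
  have T2 := gen _ skk U hU1
  have T1' : HasSum (fun m => (cc a (m - 1) : ℂ) * (kk b (m - 1) : ℂ) * U m)
      (∑' m, (cc a m : ℂ) * (kk b m : ℂ) * U (m + 1)) := by
    rw [← (Equiv.addRight (1 : ℤ)).hasSum_iff]
    refine T1.hasSum.congr_fun ?_
    intro m; simp
  have T3 := T1'.sub T2.hasSum
  have T4 : ‖(∑' m, (cc a m : ℂ) * (kk b m : ℂ) * U (m + 1)) -
      ∑' m, (cc a m : ℂ) * (kk b m : ℂ) * U m‖ ≤ (a + 2 * b) * √(3 * b / a) := by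
    rw [← T3.tsum_eq]
    refine (tsum_of_norm_bounded kd1.hasSum fun m => ?_).trans kd2
    rw [← sub_mul, norm_mul]
    refine (mul_le_of_le_one_right (norm_nonneg _) (hU1 m)).trans (le_of_eq ?_)
    rw [← Complex.ofReal_mul, ← Complex.ofReal_mul, ← Complex.ofReal_sub, Complex.norm_real,
      Real.norm_eq_abs]
  have e : φ (EE (j + n)) (EE k) - φ (EE j) (EE (n + k)) = U (0 + 1) - U 0 := by
    simp only [hU]
    rw [show j + n = n * (0 + 1) + j by ring, show n * (-(0 + 1)) + (n + k) = k by ring,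
      show n * 0 + j = j by ring, show n * (-0) + (n + k) = n + k by ring]
  rw [e]
  rw [C1, C2]
  set X := ∑' m, (cc a m : ℂ) * ((δ m - kk b m : ℝ) : ℂ) * U (m + 1)
  set Y := ∑' m, (cc a m : ℂ) * ((δ m - kk b m : ℝ) : ℂ) * U m
  set Z := ∑' m, (cc a m : ℂ) * (kk b m : ℂ) * U (m + 1)
  set W := ∑' m, (cc a m : ℂ) * (kk b m : ℂ) * U m
  calc ‖X + Z - (Y + W)‖ = ‖X - Y + (Z - W)‖ := by congr 1; ring
    _ ≤ ‖X - Y‖ + ‖Z - W‖ := norm_add_le _ _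
    _ ≤ (‖X‖ + ‖Y‖) + ‖Z - W‖ := by gcongr; exact norm_sub_le _ _
    _ ≤ _ := by linarith

lemma const_bound : 32.6 ≤ 12 * √(Real.pi * (1 + √2)) := by
  have h1 : (1.414 : ℝ) ≤ √2 := Real.le_sqrt_of_sq_le (by norm_num)
  have h2 := Real.pi_gt_d2
  have h3 : (32.6 / 12 : ℝ) ≤ √(Real.pi * (1 + √2)) := by
    apply Real.le_sqrt_of_sq_le
    nlinarith
  linarith

lemma exp_bound (φ : (Circle2Pi → ℂ) →ₗ[ℂ] (Circle2Pi → ℂ) →ₗ[ℂ] ℂ)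
    (hφnorm : ∀ f g : Circle2Pi → ℂ, MemFourierAlg f → MemFourierAlg g →
      ‖φ f g‖ ≤ fourierAlgNorm f * fourierAlgNorm g)
    (α : ℝ) (hα0 : 0 ≤ α)
    (hdisj : ∀ f g : Circle2Pi → ℂ, MemFourierAlg f → MemFourierAlg g →
      tsupport f ∩ tsupport g = ∅ →
      ‖φ f g‖ ≤ α * fourierAlgNorm f * fourierAlgNorm g) (n j k : ℤ) :
    ‖φ (EE (j + n)) (EE k) - φ (EE j) (EE (n + k))‖ ≤
      12 * √(Real.pi * (1 + √2)) * √α := by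
  set K := 12 * √(Real.pi * (1 + √2)) with hK
  have hK1 : 32.6 ≤ K := const_bound
  have hp1 := Real.pi_gt_d2
  have hp2 := Real.pi_lt_d2
  have hu : ∀ m l, ‖φ (EE m) (EE l)‖ ≤ 1 := fun m l => by
    refine (hφnorm _ _ (EE_mem m) (EE_mem l)).trans ?_
    exact mul_le_one₀ (EE_algNorm m) (algNorm_nonneg _) (EE_algNorm l)
  have key : ∀ ε : ℝ, 0 < ε → α ≤ ε ^ 2 →
      ‖φ (EE (j + n)) (EE k) - φ (EE j) (EE (n + k))‖ ≤ K * ε := by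
    intro ε hε hαε
    rcases le_or_gt (3 * ε) 1 with h | h
    · have := core φ hφnorm α hα0 hdisj (3 * ε) (3.03 * ε) (by linarith) (by linarith)
        (by linarith) n j k
      refine this.trans ?_
      have e1 : 3 * (3.03 * ε) / (3 * ε) = 3.03 := by field_simp
      have e2 : √(3.03 : ℝ) ≤ 1.741 := by
        rw [Real.sqrt_le_left (by norm_num)]; norm_num
      have e3 : 2 * (α * (2 * Real.pi / (3 * ε)) * 4) ≤ 2 * (ε ^ 2 * (2 * Real.pi / (3 * ε)) * 4) := by
        gcongr
      have e4 : 2 * (ε ^ 2 * (2 * Real.pi / (3 * ε)) * 4) = (16 * Real.pi / 3) * ε := by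
        field_simp; ring
      rw [e1]
      have e5 : (3 * ε + 2 * (3.03 * ε)) * √3.03 ≤ (3 * ε + 2 * (3.03 * ε)) * 1.741 := by gcongr
      rw [e4] at e3
      nlinarith
    · refine (norm_sub_le _ _).trans ?_
      have := hu (j + n) k
      have := hu j (n + k)
      nlinarith
  refine le_of_forall_pos_le_add fun δ hδ => ?_
  have hKp : 0 < K := by linarith
  have := key (√α + δ / K) (by positivity) (by
    have h1 := Real.sq_sqrt hα0
    have h2 := Real.sqrt_nonneg α
    have h3 : 0 < δ / K := by positivity
    nlinarith)
  rwa [mul_add, mul_div_cancel₀ _ hKp.ne'] at this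

theorem stmt_2 (φ : (Circle2Pi → ℂ) →ₗ[ℂ] (Circle2Pi → ℂ) →ₗ[ℂ] ℂ)
    (hφnorm : ∀ f g : Circle2Pi → ℂ, MemFourierAlg f → MemFourierAlg g →
      ‖φ f g‖ ≤ fourierAlgNorm f * fourierAlgNorm g)
    (α : ℝ) (hα0 : 0 ≤ α) (hα1 : α ≤ 1)
    (hdisj : ∀ f g : Circle2Pi → ℂ, MemFourierAlg f → MemFourierAlg g →
      tsupport f ∩ tsupport g = ∅ →
      ‖φ f g‖ ≤ α * fourierAlgNorm f * fourierAlgNorm g) :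
    ∀ f g h : Circle2Pi → ℂ, MemFourierAlg f → MemFourierAlg g → MemFourierAlg h →
      ‖φ (fun s => f s * g s) h - φ f (fun s => g s * h s)‖ ≤
        12 * Real.sqrt (Real.pi * (1 + Real.sqrt 2)) * Real.sqrt α *
          (fourierAlgNorm f * fourierAlgNorm g * fourierAlgNorm h) := by
  set C := 12 * Real.sqrt (Real.pi * (1 + Real.sqrt 2)) * Real.sqrt α with hC
  have hE := exp_bound φ hφnorm α hα0 hdisj
  have hEE : ∀ m l : ℤ, (fun s => EE m s * EE l s) = EE (m + l) := fun m l => by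
    funext s; rw [EE_add]
  have Db : ∀ f g h : Circle2Pi → ℂ, MemFourierAlg f → MemFourierAlg g → MemFourierAlg h →
      ‖φ (fun s => f s * g s) h - φ f (fun s => g s * h s)‖ ≤
        2 * (fourierAlgNorm f * fourierAlgNorm g * fourierAlgNorm h) := by
    intro f g h hf hg hh
    have h1 := (hφnorm _ _ (mul_mem hf hg).1 hh).trans
      (mul_le_mul_of_nonneg_right (mul_mem hf hg).2 (algNorm_nonneg h))
    have h2 := (hφnorm _ _ hf (mul_mem hg hh).1).trans
      (mul_le_mul_of_nonneg_left (mul_mem hg hh).2 (algNorm_nonneg f))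
    refine (norm_sub_le _ _).trans ((add_le_add h1 h2).trans (le_of_eq ?_))
    ring
  have step1 : ∀ (j n : ℤ) (h : Circle2Pi → ℂ), MemFourierAlg h →
      ‖φ (fun s => EE j s * EE n s) h - φ (EE j) (fun s => EE n s * h s)‖ ≤
        C * fourierAlgNorm h := by
    intro j n h hh
    refine functional_bound
      (φ (fun s => EE j s * EE n s) - (φ (EE j)).comp (LinearMap.mulLeft ℂ (EE n)))
      (2 * (fourierAlgNorm (EE j) * fourierAlgNorm (EE n))) C ?_ ?_ h hh
    · intro f hf
      refine (Db (EE j) (EE n) f (EE_mem _) (EE_mem _) hf).trans (le_of_eq ?_)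
      ring
    · intro k
      have := hE n j k
      rw [← hEE, ← hEE] at this
      exact this
  have step2 : ∀ (j : ℤ) (g h : Circle2Pi → ℂ), MemFourierAlg g → MemFourierAlg h →
      ‖φ (fun s => EE j s * g s) h - φ (EE j) (fun s => g s * h s)‖ ≤
        C * fourierAlgNorm h * fourierAlgNorm g := by
    intro j g h hg hh
    refine functional_bound
      ((φ.flip h).comp (LinearMap.mulLeft ℂ (EE j)) - (φ (EE j)).comp (LinearMap.mulRight ℂ h))
      (2 * (fourierAlgNorm (EE j) * fourierAlgNorm h)) _ ?_ ?_ g hg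
    · intro f hf
      refine (Db (EE j) f h (EE_mem _) hf hh).trans (le_of_eq ?_)
      ring
    · intro n
      exact step1 j n h hh
  intro f g h hf hg hh
  have := functional_bound
      ((φ.flip h).comp (LinearMap.mulRight ℂ g) - φ.flip (fun s => g s * h s))
      (2 * (fourierAlgNorm g * fourierAlgNorm h)) (C * fourierAlgNorm h * fourierAlgNorm g)
      (fun f' hf' => (Db f' g h hf' hg hh).trans (le_of_eq (by ring)))
      (fun j => step2 j g h hg hh) f hf
  refine le_trans this (le_of_eq ?_)
  ring
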